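/- Lemma (lattice points of a Minkowski sum of similar lattice triangles). Let T ⊂ ℝ² be a nondegenerate triangle, and let T₁ and T₂ be translates of positive real multiples of T (i.e., T₁ = x + λT and T₂ = y + μT for some x, y ∈ ℝ² and real λ, μ > 0) such that all three vertices of T₁ and all three vertices of T₂ lie in ℤ². Then every lattice point of the Minkowski sum T₁ + T₂ can be written as the sum of a lattice point of T₁ and a lattice point of T₂; that is, (T₁ + T₂) ∩ ℤ² = (T₁ ∩ ℤ²) + (T₂ ∩ ℤ²). -/

import Mathlib

open scoped Pointwise

/-- The standard lattice `ℤ²` viewed inside `ℝ²`. -/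
def latticeR2 : Set (ℝ × ℝ) := {u | ∃ m : ℤ × ℤ, u = ((m.1 : ℝ), (m.2 : ℝ))}

theorem st_lat_add {u v : ℝ × ℝ} (hu : u ∈ latticeR2) (hv : v ∈ latticeR2) :
    u + v ∈ latticeR2 := by
  obtain ⟨m, rfl⟩ := hu
  obtain ⟨k, rfl⟩ := hv
  exact ⟨m + k, by simp⟩

theorem st_lat_sub {u v : ℝ × ℝ} (hu : u ∈ latticeR2) (hv : v ∈ latticeR2) :
    u - v ∈ latticeR2 := by
  obtain ⟨m, rfl⟩ := hu
  obtain ⟨k, rfl⟩ := hv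
  exact ⟨m - k, by simp⟩

theorem st_lat_smul {u : ℝ × ℝ} (hu : u ∈ latticeR2) (k : ℤ) :
    (k : ℝ) • u ∈ latticeR2 := by
  obtain ⟨m, rfl⟩ := hu
  exact ⟨(k * m.1, k * m.2), by simp⟩

theorem st_lat_nsmul {u : ℝ × ℝ} (hu : u ∈ latticeR2) (k : ℕ) :
    (k : ℝ) • u ∈ latticeR2 := by
  have := st_lat_smul hu (k : ℤ)
  simpa using this

theorem st_mem_tri (A B C x : ℝ × ℝ) :
    x ∈ convexHull ℝ ({A, B, C} : Set (ℝ × ℝ)) ↔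
      ∃ a b c : ℝ, 0 ≤ a ∧ 0 ≤ b ∧ 0 ≤ c ∧ a + b + c = 1 ∧ x = a • A + b • B + c • C := by
  constructor
  · rw [convexHull_insert (by simp), convexHull_pair, mem_convexJoin]
    rintro ⟨a, ha, y, ⟨s, t, hs, ht, hst, rfl⟩, ⟨s', t', hs', ht', hst', rfl⟩⟩
    rw [Set.mem_singleton_iff] at ha
    subst ha
    refine ⟨s', t' * s, t' * t, hs', by positivity, by positivity, ?_, ?_⟩
    · rw [add_assoc, ← mul_add, hst, mul_one, hst']
    · rw [smul_add, smul_smul, smul_smul, add_assoc]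
  · rintro ⟨a, b, c, ha, hb, hc, h, rfl⟩
    have hcv := convex_convexHull ℝ ({A, B, C} : Set (ℝ × ℝ))
    have hA : A ∈ convexHull ℝ ({A, B, C} : Set (ℝ × ℝ)) := subset_convexHull _ _ (by simp)
    have hB : B ∈ convexHull ℝ ({A, B, C} : Set (ℝ × ℝ)) := subset_convexHull _ _ (by simp)
    have hC : C ∈ convexHull ℝ ({A, B, C} : Set (ℝ × ℝ)) := subset_convexHull _ _ (by simp)
    have := hcv.sum_mem (t := Finset.univ) (w := ![a, b, c]) (z := ![A, B, C])
      (by intro i _; fin_cases i <;> simpa) (by simp [Fin.sum_univ_three, h])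
      (by intro i _; fin_cases i <;> simpa)
    simpa [Fin.sum_univ_three] using this

def stDet (A B C : ℝ × ℝ) : ℝ :=
  (B.1 - A.1) * (C.2 - A.2) - (B.2 - A.2) * (C.1 - A.1)

theorem st_det_int {A B C : ℝ × ℝ} (hA : A ∈ latticeR2) (hB : B ∈ latticeR2)
    (hC : C ∈ latticeR2) : ∃ n : ℤ, stDet A B C = n := by
  obtain ⟨a, rfl⟩ := hA
  obtain ⟨b, rfl⟩ := hB
  obtain ⟨c, rfl⟩ := hC
  exact ⟨(b.1 - a.1) * (c.2 - a.2) - (b.2 - a.2) * (c.1 - a.1), by simp [stDet]⟩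

theorem st_min (c1 c2 c3 w1 w2 w3 : ℝ) (h1 : 0 ≤ c1) (h2 : 0 ≤ c2) (h3 : 0 ≤ c3)
    (g1 : 0 ≤ w1) (g2 : 0 ≤ w2) (g3 : 0 ≤ w3) (h : w1 + w2 + w3 = 1) :
    ∃ t : ℝ, 0 ≤ t ∧ t * w1 ≤ c1 ∧ t * w2 ≤ c2 ∧ t * w3 ≤ c3 ∧
      ((0 < w1 ∧ t * w1 = c1) ∨ (0 < w2 ∧ t * w2 = c2) ∨ (0 < w3 ∧ t * w3 = c3)) := by
  have key : ∀ i ∈ (Finset.univ : Finset (Fin 3)), 0 ≤ (![c1, c2, c3] i) ∧ 0 ≤ (![w1, w2, w3] i) := by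
    intro i _
    fin_cases i <;> simp [*]
  have hne : (Finset.univ.filter (fun i : Fin 3 => 0 < ![w1, w2, w3] i)).Nonempty := by
    by_contra hcon
    rw [Finset.not_nonempty_iff_eq_empty, Finset.filter_eq_empty_iff] at hcon
    have a1 := hcon (Finset.mem_univ 0)
    have a2 := hcon (Finset.mem_univ 1)
    have a3 := hcon (Finset.mem_univ 2)
    simp at a1 a2 a3
    linarith
  obtain ⟨i, hi, hmin⟩ := Finset.exists_min_image _ (fun i => ![c1, c2, c3] i / ![w1, w2, w3] i) hne
  have hi' := (Finset.mem_filter.1 hi).2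
  have hall : ∀ j : Fin 3, (![c1, c2, c3] i / ![w1, w2, w3] i) * ![w1, w2, w3] j ≤ ![c1, c2, c3] j := by
    intro j
    obtain ⟨k1, k2⟩ := key j (Finset.mem_univ j)
    rcases k2.eq_or_lt with k | k
    · rw [← k]; simpa using k1
    · have := hmin j (by simp only [Finset.mem_filter, Finset.mem_univ, true_and]; exact k)
      exact (le_div_iff₀ k).1 this
  refine ⟨![c1, c2, c3] i / ![w1, w2, w3] i, div_nonneg (key i (Finset.mem_univ i)).1 hi'.le,
    hall 0, hall 1, hall 2, ?_⟩
  have heq : (![c1, c2, c3] i / ![w1, w2, w3] i) * ![w1, w2, w3] i = ![c1, c2, c3] i :=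
    div_mul_cancel₀ _ hi'.ne'
  revert heq hi'
  generalize ![c1, c2, c3] i / ![w1, w2, w3] i = t
  intro hi' heq
  fin_cases i
  · exact Or.inl ⟨hi', heq⟩
  · exact Or.inr (Or.inl ⟨hi', heq⟩)
  · exact Or.inr (Or.inr ⟨hi', heq⟩)

/-- Either all coefficients are integers or there is a nonvertex lattice point. -/
theorem st_step (A B C z : ℝ × ℝ) (hA : A ∈ latticeR2) (hB : B ∈ latticeR2) (hC : C ∈ latticeR2)
    (hz : z ∈ latticeR2) (N : ℕ) (a b c : ℝ) (hs : a + b + c = N)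
    (hzz : z = a • A + b • B + c • C) :
    (a = ⌊a⌋ ∧ b = ⌊b⌋ ∧ c = ⌊c⌋) ∨
    ∃ w1 w2 w3 : ℝ, 0 ≤ w1 ∧ 0 ≤ w2 ∧ 0 ≤ w3 ∧ w1 < 1 ∧ w2 < 1 ∧ w3 < 1 ∧ w1 + w2 + w3 = 1 ∧
      w1 • A + w2 • B + w3 • C ∈ latticeR2 := by
  have fa := Int.floor_add_fract a
  have fb := Int.floor_add_fract b
  have fc := Int.floor_add_fract c
  have a0 := Int.fract_nonneg a
  have b0 := Int.fract_nonneg b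
  have c0 := Int.fract_nonneg c
  have a1 := Int.fract_lt_one a
  have b1 := Int.fract_lt_one b
  have c1 := Int.fract_lt_one c
  have hlat : Int.fract a • A + Int.fract b • B + Int.fract c • C ∈ latticeR2 := by
    have : Int.fract a • A + Int.fract b • B + Int.fract c • C =
        z - ((⌊a⌋ : ℝ) • A + (⌊b⌋ : ℝ) • B + (⌊c⌋ : ℝ) • C) := by
      rw [hzz]
      simp only [Int.fract]
      module
    rw [this]
    exact st_lat_sub hz (st_lat_add (st_lat_add (st_lat_smul hA _) (st_lat_smul hB _))
      (st_lat_smul hC _))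
  have hsum : Int.fract a + Int.fract b + Int.fract c = ((N - ⌊a⌋ - ⌊b⌋ - ⌊c⌋ : ℤ) : ℝ) := by
    push_cast
    linarith
  generalize (N - ⌊a⌋ - ⌊b⌋ - ⌊c⌋ : ℤ) = k at hsum
  have k0 : 0 ≤ k := by
    have : (0 : ℝ) ≤ k := by linarith
    exact_mod_cast this
  have k3 : k < 3 := by
    have : (k : ℝ) < 3 := by linarith
    exact_mod_cast this
  interval_cases k
  · left
    norm_num at hsum
    refine ⟨?_, ?_, ?_⟩ <;> linarith
  · right
    norm_num at hsum
    exact ⟨_, _, _, a0, b0, c0, a1, b1, c1, hsum, hlat⟩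
  · right
    norm_num at hsum
    refine ⟨1 - Int.fract a, 1 - Int.fract b, 1 - Int.fract c, by linarith, by linarith,
      by linarith, by linarith, by linarith, by linarith, by linarith, ?_⟩
    have : (1 - Int.fract a) • A + (1 - Int.fract b) • B + (1 - Int.fract c) • C =
      A + B + C - (Int.fract a • A + Int.fract b • B + Int.fract c • C) := by module
    rw [this]
    exact st_lat_sub (st_lat_add (st_lat_add hA hB) hC) hlat

theorem st_det_drop (D : ℕ) (A B C A' B' C' : ℝ × ℝ) (hA : A ∈ latticeR2) (hB : B ∈ latticeR2)
    (hC : C ∈ latticeR2) (hA' : A' ∈ latticeR2) (hB' : B' ∈ latticeR2)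
    (hC' : C' ∈ latticeR2) (t : ℝ) (ht : 0 < t) (ht1 : t < 1) (hd : stDet A B C ≠ 0)
    (hD : |stDet A B C| ≤ ((D + 1 : ℕ) : ℝ)) (h : stDet A' B' C' = t * stDet A B C) :
    stDet A' B' C' ≠ 0 ∧ |stDet A' B' C'| ≤ D := by
  refine ⟨by rw [h]; positivity, ?_⟩
  obtain ⟨k, hk⟩ := st_det_int hA' hB' hC'
  have h1 : |stDet A' B' C'| < ((D + 1 : ℕ) : ℝ) := by
    rw [h, abs_mul, abs_of_pos ht]
    have : 0 < |stDet A B C| := abs_pos.2 hd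
    nlinarith
  rw [hk] at h1 ⊢
  have h2 : |k| < D + 1 := by exact_mod_cast h1
  have h3 : |k| ≤ D := by omega
  exact_mod_cast h3

theorem st_main (D : ℕ) : ∀ (A B C z : ℝ × ℝ) (_ : A ∈ latticeR2) (_ : B ∈ latticeR2)
    (_ : C ∈ latticeR2) (_ : z ∈ latticeR2) (N : ℕ) (a b c : ℝ) (_ : 0 ≤ a) (_ : 0 ≤ b)
    (_ : 0 ≤ c) (_ : a + b + c = N) (_ : z = a • A + b • B + c • C)
    (_ : stDet A B C ≠ 0) (_ : |stDet A B C| ≤ D),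
    ∃ A' B' C' : ℝ × ℝ, A' ∈ latticeR2 ∧ B' ∈ latticeR2 ∧ C' ∈ latticeR2 ∧
      A' ∈ convexHull ℝ ({A, B, C} : Set (ℝ × ℝ)) ∧ B' ∈ convexHull ℝ ({A, B, C} : Set (ℝ × ℝ)) ∧
      C' ∈ convexHull ℝ ({A, B, C} : Set (ℝ × ℝ)) ∧
      ∃ i j k : ℕ, i + j + k = N ∧ z = (i : ℝ) • A' + (j : ℝ) • B' + (k : ℝ) • C' := by
  induction D with
  | zero =>
    intro A B C z _ _ _ _ N a b c _ _ _ _ _ hd hD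
    exact absurd (abs_nonpos_iff.1 (by simpa using hD)) hd
  | succ D ih =>
    intro A B C z hA hB hC hz N a b c ha hb hc hs hzz hd hD
    have mA : A ∈ convexHull ℝ ({A, B, C} : Set (ℝ × ℝ)) := subset_convexHull _ _ (by simp)
    have mB : B ∈ convexHull ℝ ({A, B, C} : Set (ℝ × ℝ)) := subset_convexHull _ _ (by simp)
    have mC : C ∈ convexHull ℝ ({A, B, C} : Set (ℝ × ℝ)) := subset_convexHull _ _ (by simp)
    rcases st_step A B C z hA hB hC hz N a b c hs hzz with ⟨h1, h2, h3⟩ |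
      ⟨w1, w2, w3, p1, p2, p3, l1, l2, l3, hw, hW⟩
    · refine ⟨A, B, C, hA, hB, hC, mA, mB, mC, ?_⟩
      obtain ⟨i, hi⟩ := Int.eq_ofNat_of_zero_le (Int.floor_nonneg.2 ha)
      obtain ⟨j, hj⟩ := Int.eq_ofNat_of_zero_le (Int.floor_nonneg.2 hb)
      obtain ⟨k, hk⟩ := Int.eq_ofNat_of_zero_le (Int.floor_nonneg.2 hc)
      rw [hi] at h1
      rw [hj] at h2
      rw [hk] at h3
      simp only [Int.cast_natCast] at h1 h2 h3
      refine ⟨i, j, k, ?_, ?_⟩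
      · rw [h1, h2, h3] at hs
        exact_mod_cast hs
      · rw [hzz, h1, h2, h3]
    · have mW : w1 • A + w2 • B + w3 • C ∈ convexHull ℝ ({A, B, C} : Set (ℝ × ℝ)) :=
        (st_mem_tri _ _ _ _).2 ⟨w1, w2, w3, p1, p2, p3, hw, rfl⟩
      have hsub : ∀ X Y Z : ℝ × ℝ, X ∈ convexHull ℝ ({A, B, C} : Set (ℝ × ℝ)) →
          Y ∈ convexHull ℝ ({A, B, C} : Set (ℝ × ℝ)) → Z ∈ convexHull ℝ ({A, B, C} : Set (ℝ × ℝ)) →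
          convexHull ℝ ({X, Y, Z} : Set (ℝ × ℝ)) ⊆ convexHull ℝ ({A, B, C} : Set (ℝ × ℝ)) := by
        intro X Y Z hX hY hZ
        refine convexHull_min ?_ (convex_convexHull _ _)
        rintro _ (rfl | rfl | rfl) <;> assumption
      have hw1 : w1 = 1 - w2 - w3 := by linarith
      obtain ⟨t, t0, t1, t2, t3, hor⟩ := st_min a b c w1 w2 w3 ha hb hc p1 p2 p3 hw
      have fin : ∀ X Y Z : ℝ × ℝ, X ∈ latticeR2 → Y ∈ latticeR2 → Z ∈ latticeR2 →
          X ∈ convexHull ℝ ({A, B, C} : Set (ℝ × ℝ)) →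
          Y ∈ convexHull ℝ ({A, B, C} : Set (ℝ × ℝ)) →
          Z ∈ convexHull ℝ ({A, B, C} : Set (ℝ × ℝ)) →
          ∀ x y v s : ℝ, 0 ≤ x → 0 ≤ y → 0 ≤ v → x + y + v = N →
          z = x • X + y • Y + v • Z → 0 < s → s < 1 →
          stDet X Y Z = s * stDet A B C →
          ∃ A' B' C' : ℝ × ℝ, A' ∈ latticeR2 ∧ B' ∈ latticeR2 ∧ C' ∈ latticeR2 ∧
            A' ∈ convexHull ℝ ({A, B, C} : Set (ℝ × ℝ)) ∧
            B' ∈ convexHull ℝ ({A, B, C} : Set (ℝ × ℝ)) ∧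
            C' ∈ convexHull ℝ ({A, B, C} : Set (ℝ × ℝ)) ∧
            ∃ i j k : ℕ, i + j + k = N ∧
              z = (i : ℝ) • A' + (j : ℝ) • B' + (k : ℝ) • C' := by
        intro X Y Z hX hY hZ mX mY mZ x y v s hx hy hv hxs hxz hs0 hs1 hdet
        obtain ⟨e1, e2⟩ := st_det_drop D A B C X Y Z hA hB hC hX hY hZ s hs0 hs1 hd hD hdet
        obtain ⟨A', B', C', q1, q2, q3, q4, q5, q6, q7⟩ :=
          ih X Y Z z hX hY hZ hz N x y v hx hy hv hxs hxz e1 e2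
        have hh := hsub X Y Z mX mY mZ
        exact ⟨A', B', C', q1, q2, q3, hh q4, hh q5, hh q6, q7⟩
      rcases hor with ⟨hp, he⟩ | ⟨hp, he⟩ | ⟨hp, he⟩
      · refine fin _ B C hW hB hC mW mB mC t (b - t * w2) (c - t * w3) w1 t0 (by linarith)
          (by linarith) ?_ ?_ hp l1 ?_
        · rw [← hs, ← he, hw1]; ring
        · rw [hzz, ← he]; module
        · simp only [stDet, hw1, Prod.fst_add, Prod.snd_add, Prod.smul_fst, Prod.smul_snd,
            smul_eq_mul]
          ring
      · refine fin A _ C hA hW hC mA mW mC (a - t * w1) t (c - t * w3) w2 (by linarith) t0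
          (by linarith) ?_ ?_ hp l2 ?_
        · rw [← hs, ← he, hw1]; ring
        · rw [hzz, ← he]; module
        · simp only [stDet, hw1, Prod.fst_add, Prod.snd_add, Prod.smul_fst, Prod.smul_snd,
            smul_eq_mul]
          ring
      · refine fin A B _ hA hB hW mA mB mW (a - t * w1) (b - t * w2) t w3 (by linarith)
          (by linarith) t0 ?_ ?_ hp l3 ?_
        · rw [← hs, ← he, hw1]; ring
        · rw [hzz, ← he]; module
        · simp only [stDet, hw1, Prod.fst_add, Prod.snd_add, Prod.smul_fst, Prod.smul_snd,
            smul_eq_mul]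
          ring

theorem st_collinear (p q r : ℝ × ℝ) (h : stDet p q r = 0) :
    Collinear ℝ ({p, q, r} : Set (ℝ × ℝ)) := by
  by_cases hpq : q = p
  · subst hpq
    simpa using collinear_pair ℝ q r
  · rw [collinear_iff_of_mem (p₀ := p) (by simp)]
    refine ⟨q - p, ?_⟩
    rintro _ (rfl | rfl | rfl)
    · exact ⟨0, by simp⟩
    · exact ⟨1, by simp⟩
    · rename_i y
      simp only [stDet] at h
      by_cases h1 : q.1 - p.1 = 0
      · have h2 : q.2 - p.2 ≠ 0 := by
          intro h2
          exact hpq (Prod.ext (by linarith) (by linarith))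
        have h3 : y.1 - p.1 = 0 := by
          rw [h1] at h
          have : (q.2 - p.2) * (y.1 - p.1) = 0 := by linarith
          exact (mul_eq_zero.1 this).resolve_left h2
        refine ⟨(y.2 - p.2) / (q.2 - p.2), Prod.ext ?_ ?_⟩
        · simp [h1]; linarith
        · simp; field_simp; ring
      · refine ⟨(y.1 - p.1) / (q.1 - p.1), Prod.ext ?_ ?_⟩
        · simp; field_simp; ring
        · simp; field_simp; linarith

theorem st_dvd (n m : ℕ) (hn : 0 < n) (hco : Nat.Coprime m n) (u v : ℝ × ℝ)
    (hu : u ∈ latticeR2) (hv : v ∈ latticeR2) (h : (n : ℝ) • v = (m : ℝ) • u) :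
    ∃ e ∈ latticeR2, u = (n : ℝ) • e ∧ v = (m : ℝ) • e := by
  obtain ⟨a, rfl⟩ := hu
  obtain ⟨b, rfl⟩ := hv
  have h1 : (n : ℤ) * b.1 = m * a.1 := by
    have := congrArg Prod.fst h
    simp at this
    exact_mod_cast this
  have h2 : (n : ℤ) * b.2 = m * a.2 := by
    have := congrArg Prod.snd h
    simp at this
    exact_mod_cast this
  have hc : IsCoprime (n : ℤ) (m : ℤ) := (Nat.isCoprime_iff_coprime.2 hco).symm
  obtain ⟨x, hx⟩ := hc.dvd_of_dvd_mul_left (Dvd.intro _ h1)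
  obtain ⟨y, hy⟩ := hc.dvd_of_dvd_mul_left (Dvd.intro _ h2)
  have hn' : (n : ℤ) ≠ 0 := by exact_mod_cast hn.ne'
  have hx' : b.1 = m * x := by
    apply mul_left_cancel₀ hn'
    rw [h1, hx]; ring
  have hy' : b.2 = m * y := by
    apply mul_left_cancel₀ hn'
    rw [h2, hy]; ring
  refine ⟨_, ⟨(x, y), rfl⟩, ?_, ?_⟩
  · rw [hx, hy]; simp
  · rw [hx', hy']; simp

theorem st_ratio (u v : ℝ × ℝ) (ρ : ℝ) (hρ : 0 < ρ) (hu : u ∈ latticeR2) (hv : v ∈ latticeR2)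
    (hne : u ≠ 0) (h : v = ρ • u) :
    ∃ n m : ℕ, 0 < n ∧ 0 < m ∧ Nat.Coprime m n ∧ (n : ℝ) * ρ = m := by
  obtain ⟨Q, hQ⟩ : ∃ Q : ℚ, ρ = Q := by
    obtain ⟨a, rfl⟩ := hu
    obtain ⟨b, rfl⟩ := hv
    have h1 := congrArg Prod.fst h
    have h2 := congrArg Prod.snd h
    simp at h1 h2
    by_cases ha : a.1 = 0
    · have hb : a.2 ≠ 0 := by
        intro hb
        exact hne (by simp [ha, hb])
      have hb' : (a.2 : ℝ) ≠ 0 := by exact_mod_cast hb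
      refine ⟨b.2 / a.2, ?_⟩
      push_cast
      field_simp
      linarith
    · have hb' : (a.1 : ℝ) ≠ 0 := by exact_mod_cast ha
      refine ⟨b.1 / a.1, ?_⟩
      push_cast
      field_simp
      linarith
  have hQ0 : 0 < Q := by
    rw [hQ] at hρ
    exact_mod_cast hρ
  have hnum : 0 < Q.num := Rat.num_pos.2 hQ0
  refine ⟨Q.den, Q.num.natAbs, Q.den_pos, by omega, Q.reduced, ?_⟩
  have h1 : (Q.den : ℚ) * Q = Q.num := Rat.den_mul_eq_num Q
  have h2 : ((Q.num.natAbs : ℤ)) = Q.num := by omega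
  have h3 : ((Q.den : ℚ) : ℝ) * (Q : ℝ) = ((Q.num : ℚ) : ℝ) := by exact_mod_cast h1
  rw [hQ]
  have h4 : ((Q.num.natAbs : ℕ) : ℝ) = ((Q.num : ℤ) : ℝ) := by
    rw [← Int.cast_natCast, h2]
  rw [h4]
  simpa using h3

theorem st_place (e f P A' B' C' : ℝ × ℝ) (n i j k : ℕ) (hn : 0 < n) (hs : i + j + k = n)
    (hA : A' ∈ convexHull ℝ ({0, e, f} : Set (ℝ × ℝ)))
    (hB : B' ∈ convexHull ℝ ({0, e, f} : Set (ℝ × ℝ)))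
    (hC : C' ∈ convexHull ℝ ({0, e, f} : Set (ℝ × ℝ))) :
    P + ((i : ℝ) • A' + (j : ℝ) • B' + (k : ℝ) • C') ∈
      convexHull ℝ ({P, P + (n : ℝ) • e, P + (n : ℝ) • f} : Set (ℝ × ℝ)) := by
  rw [st_mem_tri] at *
  obtain ⟨a1, b1, c1, ha1, hb1, hc1, s1, rfl⟩ := hA
  obtain ⟨a2, b2, c2, ha2, hb2, hc2, s2, rfl⟩ := hB
  obtain ⟨a3, b3, c3, ha3, hb3, hc3, s3, rfl⟩ := hC
  have hn' : (0 : ℝ) < n := by exact_mod_cast hn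
  have hs' : (i : ℝ) + j + k = n := by exact_mod_cast hs
  have hsum : (i * a1 + j * a2 + k * a3) / n + (i * b1 + j * b2 + k * b3) / n +
      (i * c1 + j * c2 + k * c3) / (n : ℝ) = 1 := by
    field_simp
    rw [← hs']
    linear_combination (i : ℝ) * s1 + (j : ℝ) * s2 + (k : ℝ) * s3
  refine ⟨(i * a1 + j * a2 + k * a3) / n, (i * b1 + j * b2 + k * b3) / n,
    (i * c1 + j * c2 + k * c3) / n, by positivity, by positivity, by positivity, hsum, ?_⟩
  have e1 : (i * a1 + j * a2 + k * a3) / (n : ℝ) = 1 - (i * b1 + j * b2 + k * b3) / n -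
      (i * c1 + j * c2 + k * c3) / (n : ℝ) := by linarith
  rw [e1]
  ext
  · simp; field_simp; ring
  · simp; field_simp; ring

theorem st_core (e f P Q : ℝ × ℝ) (n m : ℕ) (hn : 0 < n) (hm : 0 < m)
    (he : e ∈ latticeR2) (hf : f ∈ latticeR2) (hP : P ∈ latticeR2) (hQ : Q ∈ latticeR2)
    (hd : stDet 0 e f ≠ 0) :
    (convexHull ℝ ({P, P + (n : ℝ) • e, P + (n : ℝ) • f} : Set (ℝ × ℝ)) +
      convexHull ℝ ({Q, Q + (m : ℝ) • e, Q + (m : ℝ) • f} : Set (ℝ × ℝ))) ∩ latticeR2 ⊆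
    (convexHull ℝ ({P, P + (n : ℝ) • e, P + (n : ℝ) • f} : Set (ℝ × ℝ)) ∩ latticeR2) +
      (convexHull ℝ ({Q, Q + (m : ℝ) • e, Q + (m : ℝ) • f} : Set (ℝ × ℝ)) ∩ latticeR2) := by
  rintro z ⟨hz, hzl⟩
  obtain ⟨z1, h1, z2, h2, rfl⟩ := Set.mem_add.1 hz
  rw [st_mem_tri] at h1 h2
  obtain ⟨a1, b1, c1, ha1, hb1, hc1, s1, r1⟩ := h1
  obtain ⟨a2, b2, c2, ha2, hb2, hc2, s2, r2⟩ := h2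
  have h0 : (0 : ℝ × ℝ) ∈ latticeR2 := ⟨0, by simp; rfl⟩
  have e1 : a1 = 1 - b1 - c1 := by linarith
  have e2 : a2 = 1 - b2 - c2 := by linarith
  obtain ⟨D, hD⟩ := exists_nat_ge |stDet 0 e f|
  obtain ⟨A', B', C', lA, lB, lC, mA, mB, mC, i, j, k, hs, hzz⟩ :=
    st_main D 0 e f (z1 + z2 - (P + Q)) h0 he hf (st_lat_sub hzl (st_lat_add hP hQ)) (n + m)
      (n * a1 + m * a2) (n * b1 + m * b2) (n * c1 + m * c2) (by positivity) (by positivity)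
      (by positivity) (by push_cast; rw [e1, e2]; ring)
      (by rw [r1, r2, e1, e2]; module) hd hD
  obtain ⟨i1, j1, k1, i2, j2, k2, hi, hj, hk, q1, q2⟩ : ∃ i1 j1 k1 i2 j2 k2 : ℕ,
      i = i1 + i2 ∧ j = j1 + j2 ∧ k = k1 + k2 ∧ i1 + j1 + k1 = n ∧ i2 + j2 + k2 = m := by
    refine ⟨min i n, min j (n - min i n), n - min i n - min j (n - min i n),
      i - min i n, j - min j (n - min i n), k - (n - min i n - min j (n - min i n)), ?_⟩
    omega
  refine Set.mem_add.2 ⟨P + ((i1 : ℝ) • A' + (j1 : ℝ) • B' + (k1 : ℝ) • C'),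
    ⟨st_place e f P A' B' C' n i1 j1 k1 hn q1 mA mB mC, ?_⟩,
    Q + ((i2 : ℝ) • A' + (j2 : ℝ) • B' + (k2 : ℝ) • C'),
    ⟨st_place e f Q A' B' C' m i2 j2 k2 hm q2 mA mB mC, ?_⟩, ?_⟩
  · exact st_lat_add hP (st_lat_add (st_lat_add (st_lat_nsmul lA _) (st_lat_nsmul lB _))
      (st_lat_nsmul lC _))
  · exact st_lat_add hQ (st_lat_add (st_lat_add (st_lat_nsmul lA _) (st_lat_nsmul lB _))
      (st_lat_nsmul lC _))
  · rw [sub_eq_iff_eq_add] at hzz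
    rw [hzz, hi, hj, hk]
    push_cast
    module

/-- **Lemma (lattice points of a Minkowski sum of similar lattice triangles).**
Let `T` be the nondegenerate triangle with vertices `p, q, r`, and let
`T₁ = x + lam • T` and `T₂ = y + mu • T` (with `lam, mu > 0`) be translates of
positive multiples of `T` all of whose vertices are lattice points.  Then
every lattice point of `T₁ + T₂` is the sum of a lattice point of `T₁` and a
lattice point of `T₂`. -/
theorem lemma_similar_triangles (p q r x y : ℝ × ℝ) (lam mu : ℝ)
    (hcol : ¬ Collinear ℝ ({p, q, r} : Set (ℝ × ℝ)))
    (hlam : 0 < lam) (hmu : 0 < mu)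
    (h1p : x + lam • p ∈ latticeR2) (h1q : x + lam • q ∈ latticeR2)
    (h1r : x + lam • r ∈ latticeR2)
    (h2p : y + mu • p ∈ latticeR2) (h2q : y + mu • q ∈ latticeR2)
    (h2r : y + mu • r ∈ latticeR2)
    (T₁ T₂ : Set (ℝ × ℝ))
    (hT₁ : T₁ = convexHull ℝ {x + lam • p, x + lam • q, x + lam • r})
    (hT₂ : T₂ = convexHull ℝ {y + mu • p, y + mu • q, y + mu • r}) :
    (T₁ + T₂) ∩ latticeR2 = (T₁ ∩ latticeR2) + (T₂ ∩ latticeR2) := by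
  apply Set.Subset.antisymm
  · have hdet : stDet p q r ≠ 0 := fun h => hcol (st_collinear p q r h)
    have hqp : q - p ≠ 0 := by
      intro h
      apply hdet
      have : q = p := sub_eq_zero.1 h
      simp [stDet, this]
    have u1 : lam • (q - p) ∈ latticeR2 := by
      convert st_lat_sub h1q h1p using 1; module
    have u2 : lam • (r - p) ∈ latticeR2 := by
      convert st_lat_sub h1r h1p using 1; module
    have v1 : mu • (q - p) ∈ latticeR2 := by
      convert st_lat_sub h2q h2p using 1; module
    have v2 : mu • (r - p) ∈ latticeR2 := by
      convert st_lat_sub h2r h2p using 1; module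
    obtain ⟨n, m, hn, hm, hco, hnm⟩ := st_ratio (lam • (q - p)) (mu • (q - p)) (mu / lam)
      (by positivity) u1 v1 (smul_ne_zero hlam.ne' hqp)
      (by rw [smul_smul, div_mul_cancel₀ _ hlam.ne'])
    have hnm' : (n : ℝ) * mu = m * lam := by
      rw [← hnm]; field_simp
    obtain ⟨e, he, ee1, ee2⟩ := st_dvd n m hn hco _ _ u1 v1 (by rw [smul_smul, smul_smul, hnm'])
    obtain ⟨f, hf, ff1, ff2⟩ := st_dvd n m hn hco _ _ u2 v2 (by rw [smul_smul, smul_smul, hnm'])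
    have hd : stDet 0 e f ≠ 0 := by
      intro h
      apply hdet
      have g1 := congrArg Prod.fst ee1
      have g2 := congrArg Prod.snd ee1
      have g3 := congrArg Prod.fst ff1
      have g4 := congrArg Prod.snd ff1
      simp only [Prod.smul_fst, Prod.smul_snd, Prod.fst_sub, Prod.snd_sub, smul_eq_mul] at g1 g2 g3 g4
      simp only [stDet, Prod.fst_zero, Prod.snd_zero, sub_zero] at h
      have : lam ^ 2 * stDet p q r = 0 := by
        calc lam ^ 2 * stDet p q r = (lam * (q.1 - p.1)) * (lam * (r.2 - p.2)) -
              (lam * (q.2 - p.2)) * (lam * (r.1 - p.1)) := by simp only [stDet]; ring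
          _ = n ^ 2 * (e.1 * f.2 - e.2 * f.1) := by rw [g1, g2, g3, g4]; ring
          _ = 0 := by rw [h, mul_zero]
      exact (mul_eq_zero.1 this).resolve_left (by positivity)
    have key := st_core e f _ _ n m hn hm he hf h1p h2p hd
    rw [← ee1, ← ee2, ← ff1, ← ff2] at key
    have w1 : x + lam • p + lam • (q - p) = x + lam • q := by module
    have w2 : x + lam • p + lam • (r - p) = x + lam • r := by module
    have w3 : y + mu • p + mu • (q - p) = y + mu • q := by module
    have w4 : y + mu • p + mu • (r - p) = y + mu • r := by module
    rw [w1, w2, w3, w4, ← hT₁, ← hT₂] at key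
    exact key
  · rintro z hz
    obtain ⟨a, ⟨ha, ha'⟩, b, ⟨hb, hb'⟩, rfl⟩ := Set.mem_add.1 hz
    exact ⟨Set.add_mem_add ha hb, st_lat_add ha' hb'⟩
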